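/- arXiv:0901.3452 — 2 statements merged into one kernel-verified Lean document; each statement's English description precedes it below -/
import Mathlib

section
/- The series ∑_{n=1}^∞ H_n / n^4 converges and equals 3 ζ(5) − ζ(2) ζ(3). -/
theorem hasSum_prod_of_diagonal_of_offDiagonal {M : Type*} [AddCommMonoid M] [TopologicalSpace M]
    [ContinuousAdd M] {f : ℕ × ℕ → M} {a b c : M}
    (ha : HasSum (fun n : ℕ => f (n, n)) a)
    (hb : HasSum (fun p : ℕ × ℕ => f (p.1, p.1 + p.2 + 1)) b)
    (hc : HasSum (fun p : ℕ × ℕ => f (p.1 + p.2 + 1, p.1)) c) :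
    HasSum f (a + (b + c)) := by
  let e : ℕ ⊕ (ℕ × ℕ ⊕ ℕ × ℕ) → ℕ × ℕ :=
    Sum.elim (fun n => (n, n))
      (Sum.elim (fun p => (p.1, p.1 + p.2 + 1)) (fun p => (p.1 + p.2 + 1, p.1)))
  have he : Function.Bijective e := by
    constructor
    · rintro (n | ⟨m, n⟩ | ⟨m, n⟩) (n' | ⟨m', n'⟩ | ⟨m', n'⟩) h <;>
        simp only [e, Sum.elim_inl, Sum.elim_inr, Prod.mk.injEq] at h <;>
        simp only [Sum.inl.injEq, Sum.inr.injEq, Prod.mk.injEq, reduceCtorEq] <;> omega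
    · rintro ⟨m, n⟩
      rcases lt_trichotomy m n with h | h | h
      · exact ⟨.inr (.inl (m, n - m - 1)), by simp [e]; omega⟩
      · exact ⟨.inl m, by simp [e, h]⟩
      · exact ⟨.inr (.inr (n, m - n - 1)), by simp [e]; omega⟩
  have h : HasSum (f ∘ e) (a + (b + c)) :=
    HasSum.sum (f := f ∘ e) ha (HasSum.sum (f := (f ∘ e) ∘ Sum.inr) hb hc)
  exact (Equiv.ofBijective e he).hasSum_iff.mp h

theorem hasSum_one_div_sub_one_div_add (k : ℕ) :
    HasSum (fun n : ℕ => 1 / ((n : ℝ) + 1) - 1 / ((n : ℝ) + k + 1))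
      (∑ j ∈ Finset.range k, 1 / ((j : ℝ) + 1)) := by
  induction k with
  | zero => simp [hasSum_zero]
  | succ k ih =>
    have h : HasSum (fun n : ℕ => 1 / ((n : ℝ) + k + 1) - 1 / ((n : ℝ) + (k + 1 : ℕ) + 1))
        (1 / ((k : ℝ) + 1)) := by
      rw [hasSum_iff_tendsto_nat_of_nonneg]
      · have hs (N : ℕ) : ∑ n ∈ Finset.range N,
            (1 / ((n : ℝ) + k + 1) - 1 / ((n : ℝ) + (k + 1 : ℕ) + 1)) =
            1 / ((k : ℝ) + 1) - 1 / (((N + k : ℕ) : ℝ) + 1) := by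
          have := Finset.sum_range_sub' (fun n : ℕ => 1 / ((n : ℝ) + k + 1)) N
          push_cast at this ⊢
          rw [zero_add] at this
          rw [← this]
          exact Finset.sum_congr rfl fun n _ => by ring
        simp_rw [hs]
        have := (tendsto_one_div_add_atTop_nhds_zero_nat (𝕜 := ℝ)).comp
          (Filter.tendsto_add_atTop_nat k)
        simpa using this.const_sub (1 / ((k : ℝ) + 1))
      · intro n
        rw [sub_nonneg]
        apply one_div_le_one_div_of_le (by positivity)
        push_cast
        linarith
    rw [Finset.sum_range_succ]
    simpa using ih.add h

theorem summable_one_div_nat_add_one_pow {k : ℕ} (hk : 1 < k) :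
    Summable (fun n : ℕ => 1 / ((n : ℝ) + 1) ^ k) := by
  simpa using (summable_nat_add_iff 1).mpr (Real.summable_one_div_nat_pow.mpr hk)

theorem ofReal_tsum_one_div_nat_add_one_pow {k : ℕ} (hk : 1 < k) :
    ((∑' n : ℕ, 1 / ((n : ℝ) + 1) ^ k : ℝ) : ℂ) = riemannZeta k := by
  rw [zeta_eq_tsum_one_div_nat_add_one_cpow (by simpa using hk), Complex.ofReal_tsum]
  simp

theorem hasSum_harmonic_div_pow_four :
    HasSum (fun n : ℕ => (∑ j ∈ Finset.range (n + 1), 1 / ((j : ℝ) + 1)) / ((n : ℝ) + 1) ^ 4)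
      (3 * (∑' n : ℕ, 1 / ((n : ℝ) + 1) ^ 5) -
        (∑' n : ℕ, 1 / ((n : ℝ) + 1) ^ 2) * ∑' n : ℕ, 1 / ((n : ℝ) + 1) ^ 3) := by
  have s2 := summable_one_div_nat_add_one_pow (k := 2) (by norm_num)
  have s3 := summable_one_div_nat_add_one_pow (k := 3) (by norm_num)
  have s5 := summable_one_div_nat_add_one_pow (k := 5) (by norm_num)
  have hz2 := s2.hasSum
  have hz3 := s3.hasSum
  have hz5 := s5.hasSum
  generalize ∑' n : ℕ, 1 / ((n : ℝ) + 1) ^ 2 = z2 at *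
  generalize ∑' n : ℕ, 1 / ((n : ℝ) + 1) ^ 3 = z3 at *
  generalize ∑' n : ℕ, 1 / ((n : ℝ) + 1) ^ 5 = z5 at *
  have hP : Summable (fun p : ℕ × ℕ => 1 / ((p.1 : ℝ) + 1) ^ 3 * (1 / ((p.2 : ℝ) + 1) ^ 2)) :=
    s3.mul_of_nonneg s2 (fun n => by positivity) (fun n => by positivity)
  have hPs := hz3.mul hz2 hP
  have hA : Summable (fun p : ℕ × ℕ => 1 / (((p.1 : ℝ) + 1) * ((p.1 : ℝ) + p.2 + 2) ^ 4)) := by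
    refine hP.of_nonneg_of_le (fun p => by positivity) fun p => ?_
    rw [one_div_mul_one_div]
    apply one_div_le_one_div_of_le (by positivity)
    calc ((p.1 : ℝ) + 1) ^ 3 * ((p.2 : ℝ) + 1) ^ 2
        = ((p.1 : ℝ) + 1) * (((p.1 : ℝ) + 1) ^ 2 * ((p.2 : ℝ) + 1) ^ 2) := by ring
      _ ≤ ((p.1 : ℝ) + 1) * (((p.1 : ℝ) + p.2 + 2) ^ 2 * ((p.1 : ℝ) + p.2 + 2) ^ 2) := by
        gcongr <;> linarith [(p.1 : ℕ).cast_nonneg (α := ℝ), (p.2 : ℕ).cast_nonneg (α := ℝ)]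
      _ = _ := by ring
  have hB : Summable
      (fun p : ℕ × ℕ => 1 / (((p.1 : ℝ) + 1) ^ 3 * ((p.1 : ℝ) + p.2 + 2) ^ 2)) := by
    refine hP.of_nonneg_of_le (fun p => by positivity) fun p => ?_
    rw [one_div_mul_one_div]
    apply one_div_le_one_div_of_le (by positivity)
    gcongr ?_ * ?_ ^ 2
    linarith [(p.1 : ℕ).cast_nonneg (α := ℝ)]
  have hC : Summable
      (fun p : ℕ × ℕ => 1 / (((p.1 : ℝ) + 1) ^ 2 * ((p.1 : ℝ) + p.2 + 2) ^ 3)) := by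
    refine hP.of_nonneg_of_le (fun p => by positivity) fun p => ?_
    rw [one_div_mul_one_div]
    apply one_div_le_one_div_of_le (by positivity)
    calc ((p.1 : ℝ) + 1) ^ 3 * ((p.2 : ℝ) + 1) ^ 2
        = ((p.1 : ℝ) + 1) ^ 2 * (((p.1 : ℝ) + 1) * ((p.2 : ℝ) + 1) ^ 2) := by ring
      _ ≤ ((p.1 : ℝ) + 1) ^ 2 * (((p.1 : ℝ) + p.2 + 2) * ((p.1 : ℝ) + p.2 + 2) ^ 2) := by
        gcongr <;> linarith [(p.1 : ℕ).cast_nonneg (α := ℝ), (p.2 : ℕ).cast_nonneg (α := ℝ)]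
      _ = _ := by ring
  obtain ⟨a, ha⟩ := hA
  obtain ⟨b, hb⟩ := hB
  obtain ⟨c, hc⟩ := hC
  have stuffle : z3 * z2 = z5 + (b + c) := by
    refine hPs.unique (hasSum_prod_of_diagonal_of_offDiagonal ?_ ?_ ?_)
    · refine hz5.congr_fun fun n => ?_
      field_simp
    · refine hb.congr_fun fun p => ?_
      push_cast
      field_simp
      ring
    · refine hc.congr_fun fun p => ?_
      push_cast
      field_simp
      ring
  have ha' := (Equiv.prodComm ℕ ℕ).hasSum_iff.mpr ha
  have hF := ((ha.add ha').add hb).add hc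
  have hH : HasSum
      (fun n : ℕ => (∑ j ∈ Finset.range (n + 1), 1 / ((j : ℝ) + 1)) / ((n : ℝ) + 1) ^ 4)
      (a + a + b + c) := by
    refine hF.prod_fiberwise fun m => ?_
    refine ((hasSum_one_div_sub_one_div_add (m + 1)).div_const
      (((m : ℝ) + 1) ^ 4)).congr_fun fun n => ?_
    simp only [Function.comp_apply, Equiv.prodComm_apply, Prod.swap_prod_mk]
    have h1 : (m : ℝ) + n + 2 ≠ 0 := by positivity
    have h2 : (n : ℝ) + m + 2 = m + n + 2 := by ring
    have h3 : (n : ℝ) + (m + 1 : ℕ) + 1 = m + n + 2 := by push_cast; ring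
    rw [h2, h3]
    field_simp
    ring
  have hdiag : HasSum (fun n : ℕ =>
      (∑ j ∈ Finset.range (n + 1), 1 / ((j : ℝ) + 1)) / ((n : ℝ) + 2) ^ 4) a := by
    refine (Finset.HasAntidiagonal.sigmaAntidiagonalEquivProd.hasSum_iff.mpr ha).sigma fun n => ?_
    convert hasSum_fintype _ using 1
    rw [Finset.sum_div]
    trans ∑ p ∈ Finset.HasAntidiagonal.antidiagonal n, 1 / (((p.1 : ℝ) + 1) * ((p.1 : ℝ) + p.2 + 2) ^ 4)
    · rw [Finset.Nat.sum_antidiagonal_eq_sum_range_succ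
        fun i j => 1 / (((i : ℝ) + 1) * ((i : ℝ) + j + 2) ^ 4)]
      refine Finset.sum_congr rfl fun i hi => ?_
      rw [Nat.cast_sub (Nat.lt_succ_iff.mp (Finset.mem_range.mp hi)), div_div, add_sub_cancel]
    · exact (Finset.sum_coe_sort _ _).symm
  have hsplit : a + a + b + c = a + z5 := by
    have h1 := (hasSum_nat_add_iff' 1).mpr hH
    have h2 := (hasSum_nat_add_iff' 1).mpr hz5
    have h3 := h1.unique ((hdiag.add h2).congr_fun fun n => by
      rw [Finset.sum_range_succ _ (n + 1)]
      push_cast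
      have h4 : (n : ℝ) + 1 + 1 = n + 2 := by ring
      rw [h4, add_div]
      congr 1
      field_simp)
    norm_num at h3
    linarith
  convert hH using 1
  linarith

theorem euler_sum_four :
    HasSum (fun n : ℕ =>
        ((∑ j ∈ Finset.range (n + 1), (1 : ℝ) / (j + 1) : ℝ) : ℂ) / ((n : ℂ) + 1) ^ 4)
      (3 * riemannZeta 5 - riemannZeta 2 * riemannZeta 3) := by
  have h := Complex.hasSum_ofReal.mpr hasSum_harmonic_div_pow_four
  have h2 := ofReal_tsum_one_div_nat_add_one_pow (k := 2) (by norm_num)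
  have h3 := ofReal_tsum_one_div_nat_add_one_pow (k := 3) (by norm_num)
  have h5 := ofReal_tsum_one_div_nat_add_one_pow (k := 5) (by norm_num)
  rw [Complex.ofReal_sub, Complex.ofReal_mul, Complex.ofReal_mul, h2, h3, h5] at h
  exact_mod_cast h
end

section
/- For real z with 0 < z < π, ∑_{n=1}^∞ e^{−nz} log n = −(γ + log z)/z − ∑_{k=0}^∞ (−1)^k z^k ζ'(−k) / k!, where the right-hand series converges. -/
section

open MeasureTheory Set Filter Topology FourierTransform

lemma differentiableOn_integral_rpow_mul_cexp_neg_mul {a : ℝ} (ha : 0 < a) :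
    DifferentiableOn ℂ (fun c : ℂ => ∫ t : ℝ in Ioi 0, ((t ^ (a - 1) : ℝ) : ℂ) * Complex.exp (-(c * t)))
      {c : ℂ | 0 < c.re} := by
  intro c₀ hc₀
  simp only [mem_ofPred_eq] at hc₀
  have hint : ∀ p : ℝ, -1 < p → IntegrableOn (fun t : ℝ => t ^ p * Real.exp (-(c₀.re / 2) * t))
      (Ioi 0) := fun p hp => by
    simpa using integrableOn_rpow_mul_exp_neg_mul_rpow hp zero_lt_one (half_pos hc₀)
  have hmeas : ∀ p : ℝ, ∀ c : ℂ, AEStronglyMeasurable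
      (fun t : ℝ => ((t ^ p : ℝ) : ℂ) * Complex.exp (-(c * t))) (volume.restrict (Ioi 0)) :=
    fun p c => by
      refine Measurable.aestronglyMeasurable ?_
      fun_prop
  have hnorm : ∀ p : ℝ, ∀ t ∈ Ioi (0 : ℝ), ∀ c ∈ {c : ℂ | c₀.re / 2 < c.re},
      ‖((t ^ p : ℝ) : ℂ) * Complex.exp (-(c * t))‖ ≤ t ^ p * Real.exp (-(c₀.re / 2) * t) := by
    intro p t ht c hc
    simp only [mem_Ioi, mem_ofPred_eq] at ht hc
    rw [norm_mul, Complex.norm_real, Real.norm_of_nonneg (Real.rpow_nonneg ht.le _),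
      Complex.norm_exp]
    simp only [Complex.neg_re, Complex.mul_re, Complex.ofReal_re, Complex.ofReal_im, mul_zero,
      sub_zero]
    gcongr
    nlinarith
  refine ((hasDerivAt_integral_of_dominated_loc_of_deriv_le
    (μ := volume.restrict (Ioi (0 : ℝ))) (s := {c : ℂ | c₀.re / 2 < c.re})
    (bound := fun t => t ^ a * Real.exp (-(c₀.re / 2) * t))
    (F' := fun c t => -(((t ^ a : ℝ) : ℂ) * Complex.exp (-(c * t))))
    ((isOpen_lt continuous_const Complex.continuous_re).mem_nhds (half_lt_self hc₀))
    (Eventually.of_forall fun c => hmeas _ c) ?_ (hmeas a c₀).neg ?_ (hint a (by linarith))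
    ?_).2.differentiableAt).differentiableWithinAt
  · refine (hint (a - 1) (by linarith)).mono' (hmeas _ _) ?_
    filter_upwards [ae_restrict_mem measurableSet_Ioi] with t ht
    exact hnorm _ t ht c₀ (half_lt_self hc₀)
  · filter_upwards [ae_restrict_mem measurableSet_Ioi] with t ht c hc
    rw [norm_neg]
    exact hnorm _ t ht c hc
  · filter_upwards [ae_restrict_mem measurableSet_Ioi] with t ht c hc
    have h := ((((hasDerivAt_id c).mul_const (t : ℂ)).neg.cexp).const_mul ((t ^ (a - 1) : ℝ) : ℂ))
    refine h.congr_deriv ?_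
    have : t ^ a = t ^ (a - 1) * t := by
      rw [← Real.rpow_add_one (ne_of_gt ht), sub_add_cancel]
    rw [this]
    push_cast
    simp only [id, Pi.neg_apply]
    ring

lemma integral_rpow_mul_cexp_neg_mul_Ioi {a : ℝ} (ha : 0 < a) {c : ℂ} (hc : 0 < c.re) :
    ∫ t : ℝ in Ioi 0, ((t ^ (a - 1) : ℝ) : ℂ) * Complex.exp (-(c * t)) =
      Complex.Gamma a * c ^ (-(a : ℂ)) := by
  have hU : IsOpen {c : ℂ | 0 < c.re} := isOpen_lt continuous_const Complex.continuous_re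
  have hg : DifferentiableOn ℂ (fun c : ℂ => Complex.Gamma a * c ^ (-(a : ℂ))) {c : ℂ | 0 < c.re} :=
    fun c hc => ((differentiableAt_id.cpow_const (Or.inl hc)).const_mul _).differentiableWithinAt
  refine ((differentiableOn_integral_rpow_mul_cexp_neg_mul ha).analyticOnNhd
    hU).eqOn_of_preconnected_of_frequently_eq (hg.analyticOnNhd hU)
    (convex_halfSpace_re_gt 0).isPreconnected (z₀ := 1) (by simp) ?_ hc
  have hreal : ∀ r : ℝ, 0 < r → ∫ t : ℝ in Ioi 0, ((t ^ (a - 1) : ℝ) : ℂ) *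
      Complex.exp (-((r : ℂ) * t)) = Complex.Gamma a * (r : ℂ) ^ (-(a : ℂ)) := by
    intro r hr
    have h := Complex.integral_cpow_mul_exp_neg_mul_Ioi (a := a) (by simpa using ha) hr
    rw [mul_comm, Complex.cpow_neg, ← Complex.inv_cpow, ← one_div, ← h]
    · refine setIntegral_congr_fun measurableSet_Ioi fun t ht => ?_
      rw [Complex.ofReal_cpow (le_of_lt ht)]
      push_cast
      rfl
    · rw [Complex.arg_ofReal_of_nonneg hr.le]
      exact Real.pi_pos.ne
  have ht : Tendsto (fun r : ℝ => (r : ℂ)) (𝓝[≠] 1) (𝓝[≠] 1) := by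
    refine tendsto_nhdsWithin_of_tendsto_nhds_of_eventually_within _ ?_ ?_
    · exact (Complex.continuous_ofReal.tendsto' 1 1 (by simp)).mono_left nhdsWithin_le_nhds
    · filter_upwards [self_mem_nhdsWithin] with r hr
      simpa using hr
  refine ht.frequently (Eventually.frequently ?_)
  filter_upwards [nhdsWithin_le_nhds (lt_mem_nhds (zero_lt_one' ℝ))] with r hr
  exact hreal r hr

lemma Ring.choose_neg_eq_Gamma {w : ℝ} (hw : 0 < w) (k : ℕ) :
    Complex.Gamma w * Ring.choose (-(w : ℂ)) k =
      (-1) ^ k * Complex.Gamma (w + k) / (Nat.factorial k) := by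
  have hne : ∀ m : ℕ, (w : ℂ) ≠ -m := by
    intro m h
    have := congrArg Complex.re h
    simp at this
    have : (0 : ℝ) ≤ m := m.cast_nonneg
    linarith
  have h := Complex.Gamma_add_nat_div_Gamma_eq (n := k) (w : ℂ) hne
  rw [div_eq_iff (Complex.Gamma_ne_zero hne)] at h
  have h2 := Ring.factorial_nsmul_multichoose_eq_ascPochhammer (w : ℂ) k
  rw [Polynomial.ascPochhammer_smeval_eq_eval] at h2
  rw [Ring.choose_neg', h, ← h2]
  have hk : (Nat.factorial k : ℂ) ≠ 0 := by exact_mod_cast Nat.factorial_ne_zero k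
  rw [eq_div_iff hk]
  simp [Units.smul_def, Int.coe_negOnePow_natCast]
  ring

lemma hasSum_choose_mul_pow (a : ℂ) {x : ℂ} (hx : ‖x‖ < 1) :
    HasSum (fun k => Ring.choose a k * x ^ k) ((1 + x) ^ a) := by
  have := (Complex.one_add_cpow_hasFPowerSeriesOnBall_zero (a := a)).hasSum (y := x)
    (by simpa [enorm_eq_nnnorm, ← NNReal.coe_lt_coe] using hx)
  simpa [-FormalMultilinearSeries.apply_eq_prod_smul_coeff] using this

lemma summable_norm_choose_mul_pow (a : ℂ) {r : ℝ} (hr₀ : 0 ≤ r) (hr : r < 1) :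
    Summable (fun k => ‖Ring.choose a k‖ * r ^ k) := by
  have := (hasSum_choose_mul_pow a (x := r) (by simpa [abs_of_nonneg hr₀] using hr)).summable.norm
  simpa [abs_of_nonneg hr₀] using this

lemma summable_add_two_pi_I_mul_cpow_neg {w : ℝ} (hw : 1 < w) (z : ℝ) :
    Summable (fun m : ℤ => ((z : ℂ) + 2 * Real.pi * Complex.I * m) ^ (-(w : ℂ))) := by
  refine summable_of_isBigO (Real.summable_abs_int_rpow hw) (Asymptotics.IsBigO.of_bound 1 ?_)
  filter_upwards [(Set.finite_singleton (0 : ℤ)).compl_mem_cofinite] with m hm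
  have hm : (0 : ℝ) < |(m : ℝ)| := by simpa using hm
  have h1 : |(m : ℝ)| ≤ ‖(z : ℂ) + 2 * Real.pi * Complex.I * m‖ := by
    refine le_trans ?_ (Complex.abs_im_le_norm _)
    have : ((z : ℂ) + 2 * Real.pi * Complex.I * m).im = 2 * Real.pi * m := by simp
    rw [this, abs_mul, abs_of_pos Real.two_pi_pos]
    have := Real.pi_gt_three
    nlinarith
  rw [← Complex.ofReal_neg, Complex.norm_cpow_real, one_mul, Real.norm_of_nonneg (by positivity)]
  exact Real.rpow_le_rpow_of_nonpos hm h1 (by linarith)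

lemma fourier_max_rpow_mul_exp_neg_mul {w z : ℝ} (hw : 1 < w) (hz : 0 < z) (ξ : ℝ) :
    𝓕 (fun x : ℝ => (((max x 0) ^ (w - 1) * Real.exp (-(z * x)) : ℝ) : ℂ)) ξ =
      Complex.Gamma w * ((z : ℂ) + 2 * Real.pi * Complex.I * ξ) ^ (-(w : ℂ)) := by
  rw [← integral_rpow_mul_cexp_neg_mul_Ioi (by linarith) (by simpa using hz),
    Real.fourier_real_eq_integral_exp_smul, ← integral_indicator measurableSet_Ioi]
  congr 1
  ext x
  by_cases hx : 0 < x
  · rw [indicator_of_mem (mem_Ioi.mpr hx), max_eq_left hx.le]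
    push_cast
    rw [smul_eq_mul, mul_left_comm, ← Complex.exp_add]
    congr 2
    ring
  · rw [indicator_of_notMem (by simpa using hx), max_eq_right (not_lt.mp hx),
      Real.zero_rpow (by linarith)]
    simp

lemma tsum_rpow_mul_exp_neg_mul {w z : ℝ} (hw : 1 < w) (hz : 0 < z) :
    ∑' n : ℕ, ((((n + 1 : ℕ) : ℝ) ^ (w - 1) * Real.exp (-(z * (n + 1 : ℕ))) : ℝ) : ℂ) =
      ∑' m : ℤ, Complex.Gamma w * ((z : ℂ) + 2 * Real.pi * Complex.I * m) ^ (-(w : ℂ)) := by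
  set f : ℝ → ℂ := fun x : ℝ => (((max x 0) ^ (w - 1) * Real.exp (-(z * x)) : ℝ) : ℂ) with hf
  have hcont : Continuous f := by
    refine Complex.continuous_ofReal.comp (Continuous.mul ?_ (by fun_prop))
    exact (continuous_id.max continuous_const).rpow_const fun x => Or.inr (by linarith)
  have hdecay : f =O[cocompact ℝ] fun x : ℝ => |x| ^ (-2 : ℝ) := by
    rw [cocompact_eq_atBot_atTop, Asymptotics.isBigO_sup]
    constructor
    · refine Asymptotics.IsBigO.of_bound 0 ?_
      filter_upwards [eventually_le_atBot 0] with x hx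
      simp [hf, max_eq_right hx, Real.zero_rpow (sub_ne_zero.mpr hw.ne')]
    · have h1 := ((isLittleO_exp_neg_mul_rpow_atTop hz (-2 - (w - 1))).isBigO)
      have h2 := (Asymptotics.isBigO_refl (fun x : ℝ => x ^ (w - 1)) atTop).mul h1
      refine Asymptotics.IsBigO.trans (Asymptotics.IsBigO.of_bound 1 ?_)
        (h2.trans (Asymptotics.IsBigO.of_bound 1 ?_))
      · filter_upwards [eventually_gt_atTop 0] with x hx
        simp [hf, max_eq_left hx.le, Complex.norm_exp]
      · filter_upwards [eventually_gt_atTop 0] with x hx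
        rw [← Real.rpow_add hx, abs_of_pos hx, one_mul]
        simp
  have hF : ∀ m : ℤ, 𝓕 f m =
      Complex.Gamma w * ((z : ℂ) + 2 * Real.pi * Complex.I * m) ^ (-(w : ℂ)) := fun m => by
    rw [hf, fourier_max_rpow_mul_exp_neg_mul hw hz]
    simp
  have hP := Real.tsum_eq_tsum_fourier_of_rpow_decay_of_summable hcont one_lt_two hdecay
    (by simpa only [hF] using (summable_add_two_pi_I_mul_cpow_neg hw z).mul_left _) 0
  simp only [hF, zero_add, QuotientAddGroup.mk_zero, fourier_eval_zero, mul_one] at hP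
  rw [← hP]
  have hinj : Function.Injective (fun n : ℕ => (n : ℤ) + 1) := fun a b h => by simpa using h
  rw [← hinj.tsum_eq (f := fun n : ℤ => f n)]
  · refine tsum_congr fun n => ?_
    have : (0 : ℝ) ≤ n + 1 := by positivity
    simp [hf, max_eq_left this]
  · intro m hm
    by_contra hm'
    apply hm
    have : m ≤ 0 := by
      by_contra! h
      exact hm' ⟨(m - 1).toNat, by simp; omega⟩
    have : (m : ℝ) ≤ 0 := by exact_mod_cast this
    simp [hf, max_eq_right this, Real.zero_rpow (sub_ne_zero.mpr hw.ne')]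

lemma add_mul_I_cpow {z y : ℝ} (hz : 0 < z) (hy : 0 < y) (a : ℂ) :
    ((z : ℂ) + y * Complex.I) ^ a =
      (y : ℂ) ^ a * Complex.exp (Real.pi * Complex.I / 2 * a) *
        (1 + -Complex.I * (z / y : ℝ)) ^ a := by
  have hyc : (y : ℂ) ≠ 0 := by exact_mod_cast hy.ne'
  have hre : 0 < (1 + -Complex.I * (z / y : ℝ)).re := by simp
  have h1 : (1 + -Complex.I * (z / y : ℝ)) ≠ 0 := fun h => by rw [h] at hre; simp at hre
  have h : (z : ℂ) + y * Complex.I = (y : ℂ) * (Complex.I * (1 + -Complex.I * (z / y : ℝ))) := by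
    push_cast
    field_simp
    linear_combination (z : ℂ) * Complex.I_sq
  have harg := abs_lt.mp (Complex.abs_arg_lt_pi_div_two_iff.mpr (Or.inl hre))
  have him : (1 + -Complex.I * (z / y : ℝ)).arg < 0 := by
    rw [Complex.arg_neg_iff]
    simpa using div_pos hz hy
  have hpi := Real.pi_pos
  rw [h, Complex.cpow_def_of_ne_zero (mul_ne_zero hyc (mul_ne_zero Complex.I_ne_zero h1)),
    Complex.log_ofReal_mul hy (mul_ne_zero Complex.I_ne_zero h1),
    Complex.log_mul Complex.I_ne_zero h1 (by
      rw [Complex.arg_I]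
      constructor <;> linarith), Complex.log_I, Complex.cpow_def_of_ne_zero hyc,
    Complex.cpow_def_of_ne_zero h1, ← Complex.exp_add, ← Complex.exp_add, Complex.ofReal_log hy.le]
  congr 1
  ring

lemma sub_mul_I_cpow {z y : ℝ} (hz : 0 < z) (hy : 0 < y) (a : ℂ) :
    ((z : ℂ) - y * Complex.I) ^ a =
      (y : ℂ) ^ a * Complex.exp (-(Real.pi * Complex.I / 2 * a)) *
        (1 + Complex.I * (z / y : ℝ)) ^ a := by
  have hyc : (y : ℂ) ≠ 0 := by exact_mod_cast hy.ne'
  have hre : 0 < (1 + Complex.I * (z / y : ℝ)).re := by simp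
  have h1 : (1 + Complex.I * (z / y : ℝ)) ≠ 0 := fun h => by rw [h] at hre; simp at hre
  have h : (z : ℂ) - y * Complex.I = (y : ℂ) * (-Complex.I * (1 + Complex.I * (z / y : ℝ))) := by
    push_cast
    field_simp
    linear_combination (z : ℂ) * Complex.I_sq
  have harg := abs_lt.mp (Complex.abs_arg_lt_pi_div_two_iff.mpr (Or.inl hre))
  have him : 0 ≤ (1 + Complex.I * (z / y : ℝ)).arg := by
    rw [Complex.arg_nonneg_iff]
    simpa using (div_pos hz hy).le
  have hpi := Real.pi_pos
  have hI : -Complex.I ≠ 0 := neg_ne_zero.mpr Complex.I_ne_zero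
  rw [h, Complex.cpow_def_of_ne_zero (mul_ne_zero hyc (mul_ne_zero hI h1)),
    Complex.log_ofReal_mul hy (mul_ne_zero hI h1),
    Complex.log_mul hI h1 (by
      rw [Complex.arg_neg_I]
      constructor <;> linarith), Complex.log_neg_I, Complex.cpow_def_of_ne_zero hyc,
    Complex.cpow_def_of_ne_zero h1, ← Complex.exp_add, ← Complex.exp_add, Complex.ofReal_log hy.le]
  congr 1
  ring

lemma exp_mul_I_pow_add_exp_mul_neg_I_pow (w : ℂ) (k : ℕ) :
    Complex.exp (Real.pi * Complex.I / 2 * -w) * (-Complex.I) ^ k +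
      Complex.exp (-(Real.pi * Complex.I / 2 * -w)) * Complex.I ^ k =
      2 * Complex.cos (Real.pi * (w + k) / 2) := by
  have h1 : (-Complex.I) ^ k = Complex.exp (-(k * (Real.pi / 2 * Complex.I))) := by
    rw [← mul_neg, Complex.exp_nat_mul, ← neg_mul, ← neg_div, Complex.exp_neg_pi_div_two_mul_I]
  have h2 : Complex.I ^ k = Complex.exp (k * (Real.pi / 2 * Complex.I)) := by
    rw [Complex.exp_nat_mul, Complex.exp_pi_div_two_mul_I]
  rw [h1, h2, ← Complex.exp_add, ← Complex.exp_add, Complex.two_cos, add_comm]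
  congr 2 <;> ring

lemma hasSum_Gamma_mul_cpow_add_cpow {w z y : ℝ} (hw : 0 < w) (hz : 0 < z) (hzy : z < y) :
    HasSum (fun k : ℕ => (-z : ℂ) ^ k / (Nat.factorial k) * (2 * (y : ℂ) ^ (-((w : ℂ) + k)) *
        Complex.Gamma (w + k) * Complex.cos (Real.pi * (w + k) / 2)))
      (Complex.Gamma w * ((z : ℂ) + y * Complex.I) ^ (-(w : ℂ)) +
        Complex.Gamma w * ((z : ℂ) - y * Complex.I) ^ (-(w : ℂ))) := by
  have hy := hz.trans hzy
  have hyc : (y : ℂ) ≠ 0 := by exact_mod_cast hy.ne'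
  have hx : z / y < 1 := (div_lt_one hy).mpr hzy
  have hx0 : 0 < z / y := div_pos hz hy
  have h1 := hasSum_choose_mul_pow (-(w : ℂ)) (x := -Complex.I * (z / y : ℝ))
    (by simpa [abs_of_pos hz, abs_of_pos hy] using hx)
  have h2 := hasSum_choose_mul_pow (-(w : ℂ)) (x := Complex.I * (z / y : ℝ))
    (by simpa [abs_of_pos hz, abs_of_pos hy] using hx)
  have h := ((h1.mul_left ((y : ℂ) ^ (-(w : ℂ)) *
      Complex.exp (Real.pi * Complex.I / 2 * -w))).add
    (h2.mul_left ((y : ℂ) ^ (-(w : ℂ)) *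
      Complex.exp (-(Real.pi * Complex.I / 2 * -w))))).mul_left (Complex.Gamma w)
  rw [add_mul_I_cpow hz hy, sub_mul_I_cpow hz hy, ← mul_add]
  refine h.congr_fun fun k => ?_
  rw [neg_add, Complex.cpow_add _ _ hyc, Complex.cpow_neg _ (k : ℂ), Complex.cpow_natCast]
  have e1 := Ring.choose_neg_eq_Gamma hw k
  have e2 := exp_mul_I_pow_add_exp_mul_neg_I_pow w k
  trans (Complex.Gamma w * Ring.choose (-(w : ℂ)) k) * ((y : ℂ) ^ (-(w : ℂ)) * (z ^ k / y ^ k)) *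
    (2 * Complex.cos (Real.pi * (w + k) / 2))
  · rw [e1, neg_pow (z : ℂ)]
    ring
  · rw [← e2]
    push_cast
    rw [mul_pow, mul_pow, div_pow]
    ring

lemma summable_prod_Gamma_mul_cos {w z : ℝ} (hw : 1 < w) (hz : 0 < z) (hz2 : z < 2 * Real.pi) :
    Summable (fun p : ℕ × ℕ => (-z : ℂ) ^ p.2 / (Nat.factorial p.2) *
      (2 * ((2 * Real.pi * (p.1 + 1) : ℝ) : ℂ) ^ (-((w : ℂ) + p.2)) *
        Complex.Gamma (w + p.2) * Complex.cos (Real.pi * (w + p.2) / 2))) := by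
  have hpi := Real.two_pi_pos
  have hr := summable_norm_choose_mul_pow (-(w : ℂ)) (r := z / (2 * Real.pi)) (by positivity)
    ((div_lt_one hpi).mpr hz2)
  have hq : Summable (fun m : ℕ => ((m : ℝ) + 1) ^ (-w)) := by
    simpa using (summable_nat_add_iff 1).mpr (Real.summable_nat_rpow.mpr (neg_lt_neg hw))
  refine Summable.of_norm_bounded ((Summable.mul_of_nonneg hq hr (fun m => by positivity)
    (fun k => by positivity)).mul_left (2 * ‖Complex.Gamma w‖ * (2 * Real.pi) ^ (-w))) ?_
  rintro ⟨m, k⟩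
  have hm : (0 : ℝ) < (m : ℝ) + 1 := by positivity
  have e1 := Ring.choose_neg_eq_Gamma (zero_lt_one.trans hw) k
  have hcos : ‖Complex.cos (Real.pi * (w + k) / 2)‖ ≤ 1 := by
    rw [show (Real.pi * (w + k) / 2 : ℂ) = ((Real.pi * (w + k) / 2 : ℝ) : ℂ) by push_cast; rfl,
      ← Complex.ofReal_cos, Complex.norm_real]
    exact Real.abs_cos_le_one _
  have hTm : (-z : ℂ) ^ k / (Nat.factorial k) *
      (2 * ((2 * Real.pi * (m + 1) : ℝ) : ℂ) ^ (-((w : ℂ) + k)) *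
        Complex.Gamma (w + k) * Complex.cos (Real.pi * (w + k) / 2)) =
      (Complex.Gamma w * Ring.choose (-(w : ℂ)) k) * z ^ k * 2 *
      ((2 * Real.pi * (m + 1) : ℝ) : ℂ) ^ (((-(w + k) : ℝ)) : ℂ) *
        Complex.cos (Real.pi * (w + k) / 2) := by
    rw [e1]
    push_cast
    rw [neg_pow (z : ℂ)]
    ring
  have hm1 : ((m : ℝ) + 1) ^ (-(w + k)) ≤ ((m : ℝ) + 1) ^ (-w) :=
    Real.rpow_le_rpow_of_exponent_le (by linarith [m.cast_nonneg (α := ℝ)])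
      (by linarith [k.cast_nonneg (α := ℝ)])
  have hpk : (2 * Real.pi) ^ (-(w + k)) = (2 * Real.pi) ^ (-w) / (2 * Real.pi) ^ k := by
    rw [neg_add, Real.rpow_add hpi, Real.rpow_neg hpi.le (k : ℝ), Real.rpow_natCast]
    rfl
  rw [hTm, norm_mul, norm_mul, norm_mul, norm_mul, norm_mul,
    Complex.norm_cpow_eq_rpow_re_of_pos (by positivity), Complex.ofReal_re,
    Real.mul_rpow hpi.le hm.le, hpk, norm_pow, Complex.norm_real, Real.norm_of_nonneg hz.le,
    Complex.norm_ofNat]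
  calc _ ≤ ‖Complex.Gamma w‖ * ‖Ring.choose (-(w : ℂ)) k‖ * z ^ k * 2 *
        ((2 * Real.pi) ^ (-w) / (2 * Real.pi) ^ k * ((m : ℝ) + 1) ^ (-w)) * 1 := by gcongr
    _ = _ := by
      rw [div_pow]
      ring

lemma tsum_cpow_mul_Gamma_mul_cos {w : ℝ} (hw : 1 < w) (z : ℝ) (k : ℕ) :
    ∑' m : ℕ, (-z : ℂ) ^ k / (Nat.factorial k) *
      (2 * ((2 * Real.pi * (m + 1) : ℝ) : ℂ) ^ (-((w : ℂ) + k)) *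
        Complex.Gamma (w + k) * Complex.cos (Real.pi * (w + k) / 2)) =
      (-z : ℂ) ^ k / (Nat.factorial k) * riemannZeta (1 - (w + k)) := by
  have hpi := Real.two_pi_pos
  have hre : 1 < ((w : ℂ) + k).re := by
    have : (0 : ℝ) ≤ k := k.cast_nonneg
    simp
    linarith
  rw [riemannZeta_one_sub, zeta_eq_tsum_one_div_nat_add_one_cpow hre, ← tsum_mul_left,
    ← tsum_mul_left]
  · refine tsum_congr fun m => ?_
    have : ((2 * Real.pi * (m + 1) : ℝ) : ℂ) ^ (-((w : ℂ) + k)) =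
        (2 * Real.pi : ℂ) ^ (-((w : ℂ) + k)) * (1 / (m + 1 : ℂ) ^ ((w : ℂ) + k)) := by
      rw [Complex.ofReal_mul, Complex.mul_cpow_ofReal_nonneg hpi.le (by positivity),
        one_div, ← Complex.cpow_neg]
      push_cast
      rfl
    rw [this]
    ring
  · intro n h
    rw [h] at hre
    have : (0 : ℝ) ≤ n := n.cast_nonneg
    simp at hre
    linarith
  · intro h
    simp [h] at hre

lemma tsum_rpow_mul_exp_neg_mul_eq_zeta {w z : ℝ} (hw : 1 < w) (hz : 0 < z)
    (hz2 : z < 2 * Real.pi) :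
    ∑' n : ℕ, ((((n + 1 : ℕ) : ℝ) ^ (w - 1) * Real.exp (-(z * (n + 1 : ℕ))) : ℝ) : ℂ) =
      Complex.Gamma w * (z : ℂ) ^ (-(w : ℂ)) +
        ∑' k : ℕ, (-z : ℂ) ^ k / (Nat.factorial k) * riemannZeta (1 - (w + k)) := by
  have hpi := Real.two_pi_pos
  obtain ⟨f, hf⟩ : ∃ f : ℤ → ℂ, f = fun m : ℤ =>
      Complex.Gamma w * ((z : ℂ) + 2 * Real.pi * Complex.I * m) ^ (-(w : ℂ)) := ⟨_, rfl⟩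
  have hsum : Summable f := by
    rw [hf]
    exact (summable_add_two_pi_I_mul_cpow_neg hw z).mul_left (Complex.Gamma w)
  have hinj1 : Function.Injective (fun n : ℕ => (n : ℤ) + 1) := fun a b h => by simpa using h
  have hinj2 : Function.Injective (fun n : ℕ => -((n : ℤ) + 1)) := fun a b h => by simpa using h
  have hs1 : Summable (fun n : ℕ => f (n + 1)) := hsum.comp_injective hinj1
  have hs2 : Summable (fun n : ℕ => f (-(n + 1))) := hsum.comp_injective hinj2
  have hf0 : f 0 = Complex.Gamma w * (z : ℂ) ^ (-(w : ℂ)) := by simp [hf]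
  rw [tsum_rpow_mul_exp_neg_mul hw hz, ← hf, tsum_of_add_one_of_neg_add_one hs1 hs2,
    add_right_comm, ← hs1.tsum_add hs2, add_comm, hf0]
  congr 1
  obtain ⟨T, hT⟩ : ∃ T : ℕ → ℕ → ℂ, T = fun (m k : ℕ) => (-z : ℂ) ^ k / (Nat.factorial k) *
    (2 * ((2 * Real.pi * (m + 1) : ℝ) : ℂ) ^ (-((w : ℂ) + k)) *
        Complex.Gamma (w + k) * Complex.cos (Real.pi * (w + k) / 2)) :=
    ⟨_, rfl⟩
  have hrow : ∀ m : ℕ, HasSum (T m) (f (m + 1) + f (-(m + 1))) := fun m => by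
    rw [hT, hf]
    have hm : (0 : ℝ) ≤ m := m.cast_nonneg
    convert hasSum_Gamma_mul_cpow_add_cpow (w := w) (z := z) (y := 2 * Real.pi * (m + 1))
      (by linarith) hz (by nlinarith) using 4 <;> push_cast <;> ring
  have hcol : ∀ k : ℕ, ∑' m, T m k = (-z : ℂ) ^ k / (Nat.factorial k) *
      riemannZeta (1 - (w + k)) := fun k => by
    rw [hT]
    exact tsum_cpow_mul_Gamma_mul_cos hw z k
  have hswap : Summable (Function.uncurry T) := by
    rw [hT]
    exact summable_prod_Gamma_mul_cos hw hz hz2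
  rw [← tsum_congr fun k => hcol k, hswap.tsum_comm]
  exact tsum_congr fun m => (hrow m).tsum_eq.symm

lemma Complex.norm_Gamma_le {s : ℂ} (hs : 0 < s.re) : ‖Complex.Gamma s‖ ≤ Real.Gamma s.re := by
  rw [Complex.Gamma_eq_integral hs, Real.Gamma_eq_integral hs, Complex.GammaIntegral]
  refine (norm_integral_le_integral_norm _).trans_eq (setIntegral_congr_fun measurableSet_Ioi ?_)
  intro x hx
  simp only [norm_mul, Complex.norm_real, Real.norm_of_nonneg (Real.exp_pos _).le,
    Complex.norm_cpow_eq_rpow_re_of_pos hx, Complex.sub_re, Complex.one_re]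

lemma Complex.norm_cos_le_exp_abs_im (u : ℂ) : ‖Complex.cos u‖ ≤ Real.exp |u.im| := by
  have h1 : ‖Complex.exp (u * Complex.I)‖ ≤ Real.exp |u.im| := by
    rw [Complex.norm_exp]
    simpa using neg_le_abs u.im
  have h2 : ‖Complex.exp (-u * Complex.I)‖ ≤ Real.exp |u.im| := by
    rw [Complex.norm_exp]
    simpa using le_abs_self u.im
  rw [Complex.cos, norm_div, Complex.norm_ofNat, div_le_iff₀ two_pos]
  exact (norm_add_le _ _).trans (by linarith)

lemma norm_riemannZeta_le {w : ℂ} (hw : 2 ≤ w.re) :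
    ‖riemannZeta w‖ ≤ ∑' n : ℕ, ((n : ℝ) + 1) ^ (-2 : ℝ) := by
  have hq : Summable (fun m : ℕ => ((m : ℝ) + 1) ^ (-2 : ℝ)) := by
    simpa using (summable_nat_add_iff 1).mpr
      (Real.summable_nat_rpow (p := -2) |>.mpr (by norm_num))
  rw [zeta_eq_tsum_one_div_nat_add_one_cpow (by linarith)]
  refine tsum_of_norm_bounded hq.hasSum fun n => ?_
  rw [one_div, ← Complex.cpow_neg, show (n + 1 : ℂ) = ((n + 1 : ℝ) : ℂ) by push_cast; rfl,
    Complex.norm_cpow_eq_rpow_re_of_pos (by positivity)]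
  exact Real.rpow_le_rpow_of_exponent_le (by linarith [n.cast_nonneg (α := ℝ)])
    (by simpa using hw)

lemma norm_riemannZeta_one_sub_le {w : ℂ} (hw : 2 ≤ w.re) :
    ‖riemannZeta (1 - w)‖ ≤ 2 * (2 * Real.pi) ^ (-w.re) * Real.Gamma w.re *
      Real.exp (Real.pi * |w.im|) * ∑' n : ℕ, ((n : ℝ) + 1) ^ (-2 : ℝ) := by
  have hpi := Real.pi_pos
  have hG : 0 < Real.Gamma w.re := Real.Gamma_pos_of_pos (by linarith)
  rw [riemannZeta_one_sub]
  · rw [norm_mul, norm_mul, norm_mul, norm_mul, Complex.norm_ofNat,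
      show (2 * Real.pi : ℂ) = ((2 * Real.pi : ℝ) : ℂ) by push_cast; rfl,
      Complex.norm_cpow_eq_rpow_re_of_pos Real.two_pi_pos, Complex.neg_re]
    gcongr
    · exact Complex.norm_Gamma_le (by linarith)
    · refine (Complex.norm_cos_le_exp_abs_im _).trans (Real.exp_le_exp.mpr ?_)
      have : (Real.pi * w / 2 : ℂ).im = Real.pi * w.im / 2 := by simp
      rw [this, abs_div, abs_mul, abs_of_pos hpi, abs_two]
      have := mul_nonneg hpi.le (abs_nonneg w.im)
      linarith
    · exact norm_riemannZeta_le hw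
  · intro n h
    rw [h] at hw
    have : (0 : ℝ) ≤ n := n.cast_nonneg
    simp at hw
    linarith
  · intro h
    norm_num [h] at hw

lemma exists_norm_riemannZeta_sub_natCast_le :
    ∃ C : ℝ, ∀ k : ℕ, 2 ≤ k → ∀ s ∈ Metric.ball (0 : ℂ) (1 / 2),
      ‖riemannZeta (s - k)‖ ≤ C * ((2 * Real.pi) ^ k)⁻¹ * Nat.factorial (k + 1) := by
  refine ⟨2 * Real.exp Real.pi * ∑' n : ℕ, ((n : ℝ) + 1) ^ (-2 : ℝ), fun k hk s hs => ?_⟩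
  have hs : ‖s‖ < 1 / 2 := by simpa using hs
  have hre := abs_le.mp (Complex.abs_re_le_norm s)
  have him := Complex.abs_im_le_norm s
  have hk' : (2 : ℝ) ≤ k := by exact_mod_cast hk
  have hwre : (1 - s + k).re = 1 - s.re + k := by simp
  have hwim : |(1 - s + k).im| ≤ 1 := by
    simp
    linarith
  have h := norm_riemannZeta_one_sub_le (w := 1 - s + k) (by rw [hwre]; linarith)
  rw [show 1 - (1 - s + k) = s - k by ring, hwre] at h
  have hpi := Real.pi_pos
  have hZ : 0 ≤ ∑' n : ℕ, ((n : ℝ) + 1) ^ (-2 : ℝ) := tsum_nonneg fun n => by positivity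
  have hG : Real.Gamma (1 - s.re + k) ≤ Nat.factorial (k + 1) := by
    rw [← Real.Gamma_nat_eq_factorial]
    refine Real.Gamma_strictMonoOn_Ici.monotoneOn ?_ ?_ ?_ <;> simp <;> linarith
  have hG0 : 0 < Real.Gamma (1 - s.re + k) := Real.Gamma_pos_of_pos (by linarith)
  have hP : (2 * Real.pi) ^ (-(1 - s.re + k)) ≤ ((2 * Real.pi) ^ k)⁻¹ := by
    rw [← Real.rpow_natCast, ← Real.rpow_neg (by positivity)]
    exact Real.rpow_le_rpow_of_exponent_le (by linarith [Real.pi_gt_three]) (by linarith)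
  have hE : Real.exp (Real.pi * |(1 - s + k).im|) ≤ Real.exp Real.pi :=
    Real.exp_le_exp.mpr (by nlinarith)
  calc _ ≤ _ := h
    _ ≤ 2 * ((2 * Real.pi) ^ k)⁻¹ * Nat.factorial (k + 1) * Real.exp Real.pi *
        ∑' n : ℕ, ((n : ℝ) + 1) ^ (-2 : ℝ) := by gcongr
    _ = _ := by ring

lemma sub_natCast_ne_one {s : ℂ} (hs : s.re < 1) (k : ℕ) : s - k ≠ 1 := fun h => by
  have := congrArg Complex.re h
  simp at this
  linarith [k.cast_nonneg (α := ℝ)]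

lemma exists_summable_bound_zeta_taylor {z : ℝ} (hz : 0 < z) (hz2 : z < 2 * Real.pi) :
    ∃ u : ℕ → ℝ, Summable u ∧ ∀ k : ℕ, ∀ s ∈ Metric.ball (0 : ℂ) (1 / 2),
      ‖(-z : ℂ) ^ k / (Nat.factorial k) * riemannZeta (s - k)‖ ≤ u k := by
  obtain ⟨C, hC⟩ := exists_norm_riemannZeta_sub_natCast_le
  have hM : ∀ k : ℕ, ∃ M : ℝ, ∀ s ∈ Metric.closedBall (0 : ℂ) (1 / 2),
      ‖(-z : ℂ) ^ k / (Nat.factorial k) * riemannZeta (s - k)‖ ≤ M := fun k => by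
    refine (isCompact_closedBall _ _).exists_bound_of_continuousOn fun s hs => ?_
    have hs : ‖s‖ ≤ 1 / 2 := by simpa using hs
    have := (abs_le.mp (Complex.abs_re_le_norm s)).2
    have hd := (differentiableAt_riemannZeta
      (sub_natCast_ne_one (s := s) (by linarith) k)).continuousAt
    exact ((ContinuousAt.comp (f := fun s : ℂ => s - k) hd (by fun_prop)).const_mul
      _).continuousWithinAt
  choose M hM using hM
  refine ⟨fun k => if k < 2 then M k else C * ((k + 1) * (z / (2 * Real.pi)) ^ k), ?_, ?_⟩
  · have hr : ‖z / (2 * Real.pi)‖ < 1 := by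
      rw [Real.norm_of_nonneg (by positivity)]
      exact (div_lt_one Real.two_pi_pos).mpr hz2
    have h1 : Summable (fun k : ℕ => C * (((k : ℝ) + 1) * (z / (2 * Real.pi)) ^ k)) := by
      refine Summable.mul_left C ?_
      simp only [add_mul, one_mul]
      simpa using (summable_pow_mul_geometric_of_norm_lt_one 1 hr).add
        (summable_geometric_of_norm_lt_one hr)
    rw [← summable_nat_add_iff 2] at h1 ⊢
    simpa using h1
  · intro k s hs
    beta_reduce
    split_ifs with hk
    · exact hM k s (Metric.ball_subset_closedBall hs)
    · rw [norm_mul, norm_div, norm_pow, norm_neg, Complex.norm_real, Complex.norm_natCast,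
        Real.norm_of_nonneg hz.le]
      calc _ ≤ z ^ k / Nat.factorial k * (C * ((2 * Real.pi) ^ k)⁻¹ * Nat.factorial (k + 1)) := by
            gcongr
            exact hC k (not_lt.mp hk) s hs
        _ = _ := by
          rw [Nat.factorial_succ]
          have : (Nat.factorial k : ℝ) ≠ 0 := by exact_mod_cast Nat.factorial_ne_zero k
          push_cast
          rw [div_pow]
          field_simp

lemma hasDerivAt_Gamma_one_sub_mul_cpow {z : ℝ} (hz : 0 < z) :
    HasDerivAt (fun s : ℂ => Complex.Gamma (1 - s) * (z : ℂ) ^ (-(1 - s)))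
      (((Real.eulerMascheroniConstant + Real.log z) / z : ℝ) : ℂ) 0 := by
  have hzc : (z : ℂ) ≠ 0 := by exact_mod_cast hz.ne'
  have h1 : HasDerivAt (fun s : ℂ => 1 - s) (-1) 0 := by
    simpa using (hasDerivAt_id (0 : ℂ)).const_sub 1
  have hG := HasDerivAt.comp (0 : ℂ) (h := fun s : ℂ => 1 - s)
    (by simpa using Complex.hasDerivAt_Gamma_one) h1
  have hP := h1.neg.const_cpow (c := (z : ℂ)) (Or.inl hzc)
  refine (hG.mul hP).congr_deriv ?_
  simp [Complex.cpow_neg_one, Complex.ofReal_log hz.le]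
  field_simp

lemma deriv_eq_of_eq_on_neg {f g : ℂ → ℂ} (hf : DifferentiableAt ℂ f 0)
    (hg : DifferentiableAt ℂ g 0) (h : ∀ s : ℝ, s < 0 → f s = g s) : deriv f 0 = deriv g 0 := by
  have hF : HasDerivAt (fun s : ℝ => f s) (deriv f 0) 0 :=
    HasDerivAt.comp_ofReal (z := 0) (by simpa using hf.hasDerivAt)
  have hG : HasDerivAt (fun s : ℝ => g s) (deriv g 0) 0 :=
    HasDerivAt.comp_ofReal (z := 0) (by simpa using hg.hasDerivAt)
  have h0 : f (0 : ℝ) = g (0 : ℝ) := by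
    refine tendsto_nhds_unique_of_eventuallyEq (l := 𝓝[<] (0 : ℝ))
      (hF.continuousAt.tendsto.mono_left nhdsWithin_le_nhds)
      (hG.continuousAt.tendsto.mono_left nhdsWithin_le_nhds) ?_
    filter_upwards [self_mem_nhdsWithin] with s hs using h s hs
  exact (uniqueDiffWithinAt_Iio (0 : ℝ)).eq_deriv _ hF.hasDerivWithinAt
    (hG.hasDerivWithinAt.congr (fun s hs => h s hs) h0)

lemma exists_summable_bound_cpow_mul_exp {z : ℝ} (hz : 0 < z) :
    ∃ u : ℕ → ℝ, Summable u ∧ ∀ n : ℕ, ∀ s ∈ Metric.ball (0 : ℂ) (1 / 2),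
      ‖((n + 1 : ℕ) : ℂ) ^ (-s) * (Real.exp (-(n + 1 : ℕ) * z) : ℂ)‖ ≤ u n := by
  refine ⟨fun n => ((n + 1 : ℕ) : ℝ) ^ 1 * Real.exp (-z * (n + 1 : ℕ)),
    (summable_nat_add_iff 1).mpr (Real.summable_pow_mul_exp_neg_nat_mul 1 hz), fun n s hs => ?_⟩
  have hs : ‖s‖ < 1 / 2 := by simpa using hs
  have := (abs_le.mp (Complex.abs_re_le_norm s)).1
  beta_reduce
  rw [norm_mul, Complex.norm_real, Real.norm_of_nonneg (Real.exp_pos _).le,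
    Complex.norm_natCast_cpow_of_pos n.succ_pos, ← Real.rpow_natCast _ 1]
  refine mul_le_mul (Real.rpow_le_rpow_of_exponent_le ?_ ?_) (Real.exp_le_exp.mpr ?_)
    (Real.exp_pos _).le (by positivity)
  · exact_mod_cast Nat.le_add_left 1 n
  · simp
    linarith
  · exact le_of_eq (by ring)

lemma deriv_natCast_cpow_neg_mul (n : ℕ) (c : ℂ) :
    deriv (fun s : ℂ => ((n + 1 : ℕ) : ℂ) ^ (-s) * c) 0 = -(c * (Real.log (n + 1 : ℕ) : ℝ)) := by
  have hn : ((n + 1 : ℕ) : ℂ) ≠ 0 := by exact_mod_cast n.succ_ne_zero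
  have h := (((hasDerivAt_id (0 : ℂ)).neg.const_cpow (c := ((n + 1 : ℕ) : ℂ))
    (Or.inl hn)).mul_const c).deriv
  refine h.trans ?_
  rw [Complex.ofReal_log (by positivity)]
  simp
  ring

lemma tsum_cpow_neg_mul_exp_eq_zeta_taylor {z : ℝ} (hz : 0 < z) (hz2 : z < 2 * Real.pi) {s : ℝ}
    (hs : s < 0) :
    ∑' n : ℕ, ((n + 1 : ℕ) : ℂ) ^ (-(s : ℂ)) * (Real.exp (-(n + 1 : ℕ) * z) : ℂ) =
      Complex.Gamma (1 - s) * (z : ℂ) ^ (-(1 - s : ℂ)) +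
        ∑' k : ℕ, (-z : ℂ) ^ k / (Nat.factorial k) * riemannZeta (s - k) := by
  have h := tsum_rpow_mul_exp_neg_mul_eq_zeta (w := 1 - s) (by linarith) hz hz2
  rw [show (1 - s : ℂ) = ((1 - s : ℝ) : ℂ) by push_cast; rfl]
  convert h using 1
  · refine tsum_congr fun n => ?_
    rw [Complex.ofReal_mul, Complex.ofReal_cpow (by positivity)]
    push_cast
    congr 2 <;> ring
  · congr 1
    refine tsum_congr fun k => ?_
    congr 2
    push_cast
    ring

end

theorem exp_gen_log_eq_zeta_deriv (z : ℝ) (hz0 : 0 < z) (hzpi : z < Real.pi) :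
    Summable (fun k : ℕ =>
      (-1 : ℂ) ^ k * (z : ℂ) ^ k * deriv riemannZeta (-k) / (Nat.factorial k)) ∧
    ((∑' n : ℕ, Real.exp (-(n + 1 : ℕ) * z) * Real.log (n + 1 : ℕ) : ℝ) : ℂ)
      = -(((Real.eulerMascheroniConstant + Real.log z) / z : ℝ) : ℂ)
        - ∑' k : ℕ, (-1 : ℂ) ^ k * (z : ℂ) ^ k * deriv riemannZeta (-k)
            / (Nat.factorial k) := by
  have hz2 : z < 2 * Real.pi := by linarith
  obtain ⟨u, hu, hub⟩ := exists_summable_bound_cpow_mul_exp hz0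
  obtain ⟨v, hv, hvb⟩ := exists_summable_bound_zeta_taylor hz0 hz2
  have hU : IsOpen (Metric.ball (0 : ℂ) (1 / 2)) := Metric.isOpen_ball
  have h0 : (0 : ℂ) ∈ Metric.ball (0 : ℂ) (1 / 2) := by simp
  have hFd : ∀ n : ℕ, DifferentiableOn ℂ (fun s : ℂ => ((n + 1 : ℕ) : ℂ) ^ (-s) *
      (Real.exp (-(n + 1 : ℕ) * z) : ℂ)) (Metric.ball (0 : ℂ) (1 / 2)) := fun n s _ => by
    have hn : ((n + 1 : ℕ) : ℂ) ≠ 0 := by exact_mod_cast n.succ_ne_zero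
    exact ((differentiableAt_id.neg.const_cpow (Or.inl hn)).mul_const _).differentiableWithinAt
  have hGd : ∀ k : ℕ, DifferentiableOn ℂ (fun s : ℂ => (-z : ℂ) ^ k / (Nat.factorial k) *
      riemannZeta (s - k)) (Metric.ball (0 : ℂ) (1 / 2)) := fun k s hs => by
    have hs : ‖s‖ < 1 / 2 := by simpa using hs
    have := (abs_le.mp (Complex.abs_re_le_norm s)).2
    have hd := differentiableAt_riemannZeta (sub_natCast_ne_one (s := s) (by linarith) k)
    exact ((DifferentiableAt.comp (f := fun s : ℂ => s - k) s hd (by fun_prop)).const_mul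
      _).differentiableWithinAt
  have hF := Complex.hasSum_deriv_of_summable_norm hu hFd hU hub h0
  have hG := Complex.hasSum_deriv_of_summable_norm hv hGd hU hvb h0
  have hF' := (Complex.differentiableOn_tsum_of_summable_norm hu hFd hU hub).differentiableAt
    (hU.mem_nhds h0)
  have hG' := (Complex.differentiableOn_tsum_of_summable_norm hv hGd hU hvb).differentiableAt
    (hU.mem_nhds h0)
  have hH := hasDerivAt_Gamma_one_sub_mul_cpow hz0
  have key := deriv_eq_of_eq_on_neg hF' (hH.differentiableAt.add hG') fun s hs =>
    tsum_cpow_neg_mul_exp_eq_zeta_taylor hz0 hz2 hs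
  rw [deriv_add hH.differentiableAt hG', hH.deriv] at key
  have hterm : ∀ k : ℕ, deriv (fun s : ℂ => (-z : ℂ) ^ k / (Nat.factorial k) *
      riemannZeta (s - k)) 0 =
      (-1 : ℂ) ^ k * (z : ℂ) ^ k * deriv riemannZeta (-k) / (Nat.factorial k) := fun k => by
    rw [deriv_const_mul_field, deriv_comp_sub_const, zero_sub, neg_pow (z : ℂ)]
    ring
  simp only [deriv_natCast_cpow_neg_mul] at hF
  simp only [hterm] at hG
  refine ⟨hG.summable, ?_⟩
  rw [hG.tsum_eq, Complex.ofReal_tsum]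
  simp only [Complex.ofReal_mul]
  rw [← neg_neg (∑' n : ℕ, _), ← tsum_neg, hF.tsum_eq, key]
  ring
end
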